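/- Let n ≥ 3 be an integer with n ≡ 3 (mod 6). Then the set S = {λ : ℝ | ∃ p : ZMod n → ℂ, ∀ j, 1 ≤ ‖p j‖ ∧ ‖p j‖ ≤ λ ∧ 1 ≤ ‖p j - p (j-1)‖ ∧ ‖p j - p (j-1)‖ ≤ λ} has least element 2·sin((π/6)·(n/(n-1))). (Equivalently, φ_ℂ(W_n) = 1 + 2·sin((π/6)·(n/(n-1))) for n ≡ 3 mod 6.) -/

import Mathlib

open Real

lemma two_mul_sin_mul_sin_eq (x y : ℝ) :
    2 * (sin x * sin y) = cos (x - y) - cos (x + y) := by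
  rw [cos_sub, cos_add]; ring

lemma sin_sq_add_sin_sq_eq (x y : ℝ) :
    sin x ^ 2 + sin y ^ 2 = 1 - cos (x + y) * cos (x - y) := by
  rw [cos_sub, cos_add]
  linear_combination (-sin y ^ 2 + 1) * sin_sq_add_cos_sq x + cos x ^ 2 * sin_sq_add_cos_sq y

/-- Lower bound for the angle, seen from the origin, of a segment of length at least `1`
whose endpoints have norms `2 * sin x` and `2 * sin y`. -/
lemma le_abs_of_one_le_dist {x y α : ℝ} (hx : π / 6 ≤ x) (hy : π / 6 ≤ y)
    (hx' : x ≤ π / 4) (hy' : y ≤ π / 4)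
    (h : 1 ≤ (2 * sin x) ^ 2 + (2 * sin y) ^ 2 - 2 * (2 * sin x) * (2 * sin y) * cos α) :
    2 * π / 3 - x - y ≤ |α| := by
  have hpi := pi_pos
  by_contra! hlt
  have hcos : cos (2 * π / 3 - x - y) < cos |α| :=
    cos_lt_cos_of_nonneg_of_le_pi (abs_nonneg _) (by linarith) hlt
  rw [cos_abs] at hcos
  have hsx : 0 < sin x := sin_pos_of_pos_of_lt_pi (by linarith) (by linarith)
  have hsy : 0 < sin y := sin_pos_of_pos_of_lt_pi (by linarith) (by linarith)
  have hc : 0 ≤ cos (x + y - π / 3) := cos_nonneg_of_mem_Icc ⟨by linarith, by linarith⟩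
  have hd : cos (x + y - π / 3) ≤ cos (x - y) := by
    rw [← cos_abs (x - y)]
    exact cos_le_cos_of_nonneg_of_le_pi (abs_nonneg _) (by linarith)
      (abs_le.2 ⟨by linarith, by linarith⟩)
  have key : 8 * sin x * sin y * cos (2 * π / 3 - x - y)
      - (4 * sin x ^ 2 + 4 * sin y ^ 2 - 1)
      = 4 * cos (x + y - π / 3) * (cos (x - y) - cos (x + y - π / 3)) := by
    have h3 : √3 ^ 2 = 3 := sq_sqrt (by norm_num)
    have hc' : cos (x + y - π / 3) = cos (x + y) / 2 + √3 / 2 * sin (x + y) := by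
      rw [cos_sub, cos_pi_div_three, sin_pi_div_three]; ring
    have hc'' : cos (2 * π / 3 - x - y) = cos (x + y - π / 3) - cos (x + y) := by
      rw [hc', show 2 * π / 3 - x - y = π - (x + y + π / 3) by ring, cos_pi_sub, cos_add (x + y),
        cos_pi_div_three, sin_pi_div_three]
      ring
    rw [hc'', hc']
    linear_combination
      4 * (√3 / 2 * sin (x + y) - cos (x + y) / 2) * two_mul_sin_mul_sin_eq x y
        - 4 * sin_sq_add_sin_sq_eq x y + 3 * sin_sq_add_cos_sq (x + y)
        + sin (x + y) ^ 2 * h3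
  have := mul_nonneg hc (sub_nonneg.2 hd)
  have := mul_pos (mul_pos hsx hsy) (sub_pos.2 hcos)
  nlinarith

/-- Upper bound for the angle, seen from the origin, of a segment of length at most `2 * sin t`
whose endpoints have norms `2 * sin x` and `2 * sin y`. -/
lemma abs_le_of_dist_le {x y t α : ℝ} (hx : π / 6 ≤ x) (hy : π / 6 ≤ y)
    (hx' : x ≤ t) (hy' : y ≤ t) (ht : t ≤ π / 4) (hα : |α| ≤ π)
    (h : (2 * sin x) ^ 2 + (2 * sin y) ^ 2 - 2 * (2 * sin x) * (2 * sin y) * cos α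
      ≤ (2 * sin t) ^ 2) :
    |α| ≤ 2 * t + π / 3 - x - y := by
  have hpi := pi_pos
  by_contra! hlt
  have hcos : cos |α| < cos (2 * t + π / 3 - x - y) :=
    cos_lt_cos_of_nonneg_of_le_pi (by linarith) hα hlt
  rw [cos_abs] at hcos
  have hsx : 0 < sin x := sin_pos_of_pos_of_lt_pi (by linarith) (by linarith)
  have hsy : 0 < sin y := sin_pos_of_pos_of_lt_pi (by linarith) (by linarith)
  have hc : 0 ≤ cos (t + π / 6) := cos_nonneg_of_mem_Icc ⟨by linarith, by linarith⟩
  have hu0 : 0 ≤ cos (x + y - t - π / 6) :=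
    cos_nonneg_of_mem_Icc ⟨by linarith, by linarith⟩
  have hu : cos (t - π / 6) ≤ cos (x + y - t - π / 6) := by
    rw [← cos_abs (x + y - t - π / 6)]
    exact cos_le_cos_of_nonneg_of_le_pi (abs_nonneg _) (by linarith)
      (abs_le.2 ⟨by linarith, by linarith⟩)
  have ht' : cos (t + π / 6) ≤ cos (t - π / 6) :=
    cos_le_cos_of_nonneg_of_le_pi (by linarith) (by linarith) (by linarith)
  have hd : cos (x - y) ≤ 1 := cos_le_one _
  have key : (4 * sin x ^ 2 + 4 * sin y ^ 2 - 4 * sin t ^ 2)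
      - 8 * sin x * sin y * cos (2 * t + π / 3 - x - y)
      = 4 * (cos (x + y - t - π / 6) - cos (t - π / 6))
          * (cos (x + y - t - π / 6) + cos (t - π / 6) - 2 * cos (t + π / 6))
        + 8 * cos (t + π / 6) * cos (x + y - t - π / 6) * (1 - cos (x - y)) := by
    have hA : cos (x + y) = cos (t + π / 6) * cos (x + y - t - π / 6)
        - sin (t + π / 6) * sin (x + y - t - π / 6) := by
      rw [← cos_add]; ring_nf
    have hE : cos (2 * t + π / 3 - x - y) = cos (t + π / 6) * cos (x + y - t - π / 6)
        + sin (t + π / 6) * sin (x + y - t - π / 6) := by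
      rw [← cos_sub]; ring_nf
    have hP : cos (t - π / 6) = cos (t + π / 6) + sin t := by
      rw [cos_sub, cos_add, sin_pi_div_six]; ring
    have h1 := two_mul_sin_mul_sin_eq x y
    have h2 := sin_sq_add_sin_sq_eq x y
    rw [hA] at h1 h2
    rw [hE, hP]
    have hw := sin_sq_add_cos_sq (t + π / 6)
    have hu := sin_sq_add_cos_sq (x + y - t - π / 6)
    generalize cos (t + π / 6) = W at *
    generalize cos (x + y - t - π / 6) = U at *
    generalize sin (t + π / 6) = V at *
    generalize sin (x + y - t - π / 6) = R at *
    linear_combination 4 * h2 - 4 * (W * U + V * R) * h1 - 4 * R ^ 2 * hw + (4 * W ^ 2 - 4) * hu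
  have h1 := mul_nonneg (sub_nonneg.2 hu) (by linarith :
    0 ≤ cos (x + y - t - π / 6) + cos (t - π / 6) - 2 * cos (t + π / 6))
  have h2 := mul_nonneg (mul_nonneg hc hu0) (sub_nonneg.2 hd)
  have := mul_pos (mul_pos hsx hsy) (sub_pos.2 hcos)
  nlinarith

lemma forall_of_succ_imp {n : ℕ} [NeZero n] {P : ZMod n → Prop} (i : ZMod n) (hi : P i)
    (h : ∀ j, P j → P (j + 1)) (j : ZMod n) : P j := by
  have aux : ∀ m : ℕ, P (i + m) := by
    intro m
    induction m with
    | zero => simpa using hi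
    | succ m ih => simpa [add_assoc] using h _ ih
  simpa using aux (j - i).val

/-- The sign of a step, with value `-1` at `0`. -/
noncomputable def stepSign (x : ℝ) : ℤ := if 0 < x then 1 else -1

lemma stepSign_of_pos {x : ℝ} (h : 0 < x) : stepSign x = 1 := if_pos h

lemma stepSign_of_neg {x : ℝ} (h : x < 0) : stepSign x = -1 := if_neg h.not_gt

lemma stepSign_eq (x : ℝ) : stepSign x = 1 ∨ stepSign x = -1 := by
  unfold stepSign; split_ifs <;> simp

lemma stepSign_neg {x : ℝ} (h : x ≠ 0) : stepSign (-x) = -stepSign x := by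
  rcases h.lt_or_gt with h | h
  · rw [stepSign_of_neg h, stepSign_of_pos (neg_pos.2 h)]; rfl
  · rw [stepSign_of_pos h, stepSign_of_neg (neg_neg_iff_pos.2 h)]

lemma vertex_term_le {n : ℕ} {α g : ZMod n → ℝ} {e : ℝ}
    (hg : ∀ j, 0 ≤ g j) (hge : ∀ j, g j ≤ e) (j : ZMod n) :
    e + (stepSign (α j) + stepSign (α (j + 1))) * (e / 2 - g j) ≤ 2 * e := by
  have h1 := hg j
  have h2 := hge j
  rcases stepSign_eq (α j) with h | h <;> rcases stepSign_eq (α (j + 1)) with h' | h' <;>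
    rw [h, h'] <;> push_cast <;> linarith

section Steps

variable {n : ℕ} [NeZero n] {α g : ZMod n → ℝ} {c e : ℝ}

lemma sum_step_sub_le (hα : ∀ j, α j ≠ 0)
    (hlow : ∀ j, c - g j - g (j - 1) ≤ |α j|)
    (hupp : ∀ j, |α j| ≤ c + 2 * e - g j - g (j - 1)) :
    ∑ j, (α j - stepSign (α j) * c) ≤
      ∑ j, (e + (stepSign (α j) + stepSign (α (j + 1))) * (e / 2 - g j)) := by
  have h1 : ∀ j, α j - stepSign (α j) * c ≤
      (e + stepSign (α j) * (e / 2 - g j)) + stepSign (α j) * (e / 2 - g (j - 1)) := by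
    intro j
    have h1 := hlow j
    have h2 := hupp j
    rcases (hα j).lt_or_gt with h | h
    · rw [abs_of_neg h] at h1 h2
      rw [stepSign_of_neg h]; push_cast; linarith
    · rw [abs_of_pos h] at h1 h2
      rw [stepSign_of_pos h]; push_cast; linarith
  refine (Finset.sum_le_sum fun j _ => h1 j).trans_eq ?_
  rw [Finset.sum_add_distrib,
    ← Equiv.sum_comp (Equiv.addRight (1 : ZMod n)) fun j => (stepSign (α j) : ℝ) * (e / 2 - g (j - 1)),
    ← Finset.sum_add_distrib]
  refine Finset.sum_congr rfl fun j _ => ?_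
  simp only [Equiv.coe_addRight, add_sub_cancel_right]
  ring

lemma sum_step_sub_le_of_mixed (hα : ∀ j, α j ≠ 0) (hg : ∀ j, 0 ≤ g j) (hge : ∀ j, g j ≤ e)
    (hlow : ∀ j, c - g j - g (j - 1) ≤ |α j|)
    (hupp : ∀ j, |α j| ≤ c + 2 * e - g j - g (j - 1))
    (hpos : ∃ j, 0 < α j) (hneg : ∃ j, α j < 0) :
    ∑ j, (α j - stepSign (α j) * c) ≤ 2 * e * (n - 1) := by
  obtain ⟨a, ha⟩ := hpos
  obtain ⟨b, hb⟩ := hneg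
  obtain ⟨i, hi, hi'⟩ : ∃ j, 0 < α j ∧ α (j + 1) < 0 := by
    by_contra! h
    exact (forall_of_succ_imp (P := fun j => 0 < α j) a ha
      (fun j hj => (h j hj).lt_of_ne (hα _).symm) b).not_gt hb
  obtain ⟨k, hk, hk'⟩ : ∃ j, α j < 0 ∧ 0 < α (j + 1) := by
    by_contra! h
    exact (forall_of_succ_imp (P := fun j => α j < 0) b hb
      (fun j hj => (h j hj).lt_of_ne (hα _)) a).not_gt ha
  have hik : i ≠ k := by rintro rfl; linarith
  refine (sum_step_sub_le hα hlow hupp).trans ?_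
  have h1 : ∀ j ∈ Finset.univ,
      e + (stepSign (α j) + stepSign (α (j + 1))) * (e / 2 - g j) ≤
        2 * e - (if j = i then e else 0) - (if j = k then e else 0) := by
    intro j _
    by_cases hji : j = i
    · subst hji
      rw [stepSign_of_pos hi, stepSign_of_neg hi', if_pos rfl, if_neg hik]
      push_cast; linarith
    · by_cases hjk : j = k
      · subst hjk
        rw [stepSign_of_neg hk, stepSign_of_pos hk', if_neg hji, if_pos rfl]
        push_cast; linarith
      · rw [if_neg hji, if_neg hjk, sub_zero, sub_zero]
        exact vertex_term_le hg hge j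
  refine (Finset.sum_le_sum h1).trans_eq ?_
  simp [Finset.sum_sub_distrib, ZMod.card]
  ring

lemma abs_sum_step_sub_le_of_mixed (hα : ∀ j, α j ≠ 0) (hg : ∀ j, 0 ≤ g j)
    (hge : ∀ j, g j ≤ e) (hlow : ∀ j, c - g j - g (j - 1) ≤ |α j|)
    (hupp : ∀ j, |α j| ≤ c + 2 * e - g j - g (j - 1))
    (hpos : ∃ j, 0 < α j) (hneg : ∃ j, α j < 0) :
    |∑ j, (α j - stepSign (α j) * c)| ≤ 2 * e * (n - 1) := by
  refine abs_le'.2 ⟨sum_step_sub_le_of_mixed hα hg hge hlow hupp hpos hneg, ?_⟩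
  have := sum_step_sub_le_of_mixed (α := fun j => -α j) (c := c) (fun j => neg_ne_zero.2 (hα j))
    hg hge (by simpa using hlow) (by simpa using hupp) (by simpa using hneg) (by simpa using hpos)
  refine le_trans (le_of_eq ?_) this
  rw [← Finset.sum_neg_distrib]
  refine Finset.sum_congr rfl fun j _ => ?_
  rw [stepSign_neg (hα j)]
  push_cast; ring

lemma abs_sum_step_sub_le (hα : ∀ j, α j ≠ 0) (hg : ∀ j, 0 ≤ g j) (hge : ∀ j, g j ≤ e)
    (hlow : ∀ j, c - g j - g (j - 1) ≤ |α j|)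
    (hupp : ∀ j, |α j| ≤ c + 2 * e - g j - g (j - 1)) :
    |∑ j, (α j - stepSign (α j) * c)| ≤ 2 * e * n := by
  refine (Finset.abs_sum_le_sum_abs _ _).trans ?_
  have h1 : ∀ j ∈ Finset.univ, |α j - stepSign (α j) * c| ≤ 2 * e := by
    intro j _
    have h1 := hlow j
    have h2 := hupp j
    have h3 := hg j
    have h4 := hg (j - 1)
    have h5 := hge j
    have h6 := hge (j - 1)
    rw [abs_le]
    rcases (hα j).lt_or_gt with h | h
    · rw [abs_of_neg h] at h1 h2
      rw [stepSign_of_neg h]; push_cast; constructor <;> linarith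
    · rw [abs_of_pos h] at h1 h2
      rw [stepSign_of_pos h]; push_cast; constructor <;> linarith
  refine (Finset.sum_le_sum h1).trans_eq ?_
  simp [ZMod.card]
  ring

end Steps

/-- A closed walk with `n ≡ 3 (mod 6)` angular steps close to `± π / 3` cannot wind around
the origin an integral number of times. -/
lemma sum_steps_ne_two_pi_mul {n : ℕ} (hn : 3 ≤ n) (hmod : n % 6 = 3) [NeZero n]
    {α g : ZMod n → ℝ} {e : ℝ} (he : 2 * e * (n - 1) < π / 3) (hα : ∀ j, α j ≠ 0)
    (hg : ∀ j, 0 ≤ g j) (hge : ∀ j, g j ≤ e)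
    (hlow : ∀ j, π / 3 - g j - g (j - 1) ≤ |α j|)
    (hupp : ∀ j, |α j| ≤ π / 3 + 2 * e - g j - g (j - 1)) (m : ℤ) :
    ∑ j, α j ≠ 2 * π * m := by
  intro hsum
  have hpi := pi_pos
  have hn' : (3 : ℝ) ≤ n := by exact_mod_cast hn
  set s : ℤ := ∑ j, stepSign (α j) with hs
  have hr : ∑ j, (α j - stepSign (α j) * (π / 3)) = ((6 * m - s : ℤ) : ℝ) * (π / 3) := by
    rw [Finset.sum_sub_distrib, hsum, ← Finset.sum_mul, hs]
    push_cast; ring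
  by_cases hmix : (∃ j, 0 < α j) ∧ ∃ j, α j < 0
  · have h := abs_sum_step_sub_le_of_mixed hα hg hge hlow hupp hmix.1 hmix.2
    rw [hr, abs_mul, abs_of_pos (by positivity : 0 < π / 3)] at h
    have h1 : |((6 * m - s : ℤ) : ℝ)| < 1 := by
      by_contra! h'
      nlinarith
    have h2 : |6 * m - s| < 1 := by exact_mod_cast h1
    have h3 : 6 * m - s = 0 := Int.abs_lt_one_iff.1 h2
    have h4 : s % 2 = 1 := by
      have : (s : ZMod 2) = (n : ZMod 2) := by
        rw [hs, Int.cast_sum]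
        have : ∀ j ∈ Finset.univ, ((stepSign (α j) : ℤ) : ZMod 2) = 1 := by
          intro j _
          rcases stepSign_eq (α j) with h | h <;> rw [h] <;> decide
        rw [Finset.sum_congr rfl this]
        simp [ZMod.card]
      have h5 : ((s : ℤ) : ZMod 2) = ((n : ℤ) : ZMod 2) := by exact_mod_cast this
      rw [ZMod.intCast_eq_intCast_iff] at h5
      have : s % 2 = (n : ℤ) % 2 := h5
      omega
    omega
  · have h := abs_sum_step_sub_le hα hg hge hlow hupp
    rw [hr, abs_mul, abs_of_pos (by positivity : 0 < π / 3)] at h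
    have he0 : 0 ≤ e := (hg 0).trans (hge 0)
    have h1 : |((6 * m - s : ℤ) : ℝ)| < 3 := by
      by_contra! h'
      nlinarith
    have h2 : |6 * m - s| < 3 := by exact_mod_cast h1
    have h3 : s = n ∨ s = -n := by
      by_cases hp : ∃ j, 0 < α j
      · left
        have : ∀ j ∈ Finset.univ, stepSign (α j) = 1 := fun j _ =>
          stepSign_of_pos ((not_lt.1 fun hj => hmix ⟨hp, j, hj⟩).lt_of_ne (hα j).symm)
        rw [hs, Finset.sum_congr rfl this]
        simp [ZMod.card]
      · right
        have : ∀ j ∈ Finset.univ, stepSign (α j) = -1 := fun j _ =>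
          stepSign_of_neg ((not_lt.1 fun hj => hp ⟨j, hj⟩).lt_of_ne (hα j))
        rw [hs, Finset.sum_congr rfl this]
        simp [ZMod.card]
    rw [abs_lt] at h2
    omega

lemma norm_sub_sq_eq_arg_div {z w : ℂ} (hz : z ≠ 0) (hw : w ≠ 0) :
    ‖z - w‖ ^ 2 = ‖z‖ ^ 2 + ‖w‖ ^ 2 - 2 * ‖z‖ * ‖w‖ * cos (Complex.arg (z / w)) := by
  rw [Complex.cos_arg (div_ne_zero hz hw), norm_div]
  have hz' : ‖z‖ ≠ 0 := norm_ne_zero_iff.2 hz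
  have hw' : ‖w‖ ≠ 0 := norm_ne_zero_iff.2 hw
  have h : (z / w).re = (z.re * w.re + z.im * w.im) / ‖w‖ ^ 2 := by
    rw [Complex.div_re, ← Complex.normSq_eq_norm_sq]; ring
  rw [h]
  field_simp
  simp only [← Complex.normSq_eq_norm_sq, Complex.normSq_apply, Complex.sub_re, Complex.sub_im]
  ring

lemma exists_sum_arg_div_eq {n : ℕ} [NeZero n] {p : ZMod n → ℂ} (hp : ∀ j, p j ≠ 0) :
    ∃ m : ℤ, ∑ j, Complex.arg (p j / p (j - 1)) = 2 * π * m := by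
  have h : Complex.exp (∑ j, (Complex.arg (p j / p (j - 1)) : ℂ) * Complex.I) = 1 := by
    have h1 : ∀ j, Complex.exp (Complex.arg (p j / p (j - 1)) * Complex.I) =
        (p j / ‖p j‖) / (p (j - 1) / ‖p (j - 1)‖) := by
      intro j
      have h2 := Complex.norm_mul_exp_arg_mul_I (p j / p (j - 1))
      have h3 : (‖p j‖ : ℂ) ≠ 0 := by simpa using hp j
      have h4 : (‖p (j - 1)‖ : ℂ) ≠ 0 := by simpa using hp (j - 1)
      have h5 := hp (j - 1)
      rw [norm_div] at h2
      push_cast at h2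
      field_simp at h2 ⊢
      linear_combination h2
    rw [Complex.exp_sum, Finset.prod_congr rfl fun j _ => h1 j, Finset.prod_div_distrib,
      show ∏ j, p (j - 1) / (‖p (j - 1)‖ : ℂ) = ∏ j, p j / (‖p j‖ : ℂ) from
        Equiv.prod_comp (Equiv.subRight (1 : ZMod n)) fun j => p j / (‖p j‖ : ℂ)]
    refine div_self (Finset.prod_ne_zero_iff.2 fun j _ => div_ne_zero (hp j) ?_)
    simpa using hp j
  obtain ⟨m, hm⟩ := Complex.exp_eq_one_iff.1 h
  refine ⟨m, ?_⟩
  rw [← Finset.sum_mul] at hm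
  have h2 : ((∑ j, Complex.arg (p j / p (j - 1)) : ℝ) : ℂ) = ((2 * π * m : ℝ) : ℂ) := by
    apply mul_right_cancel₀ Complex.I_ne_zero
    push_cast
    rw [hm]; ring
  exact_mod_cast h2

/-- The bound `2 * sin (θ / 2)`, where `n - 1` steps of angle `θ` reach the antipode, is attained
by `n - 1` points on the unit circle together with one point of norm `2 * sin (θ / 2)`. -/
lemma exists_admissible {n : ℕ} (hn : 3 ≤ n) {z : ℂ} (hz : ‖z‖ = 1) (hz1 : 1 ≤ ‖z - 1‖)
    (hpow : z ^ (n - 1) = -1) :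
    ∃ p : ZMod n → ℂ, ∀ j : ZMod n,
      1 ≤ ‖p j‖ ∧ ‖p j‖ ≤ ‖z - 1‖ ∧ 1 ≤ ‖p j - p (j - 1)‖ ∧ ‖p j - p (j - 1)‖ ≤ ‖z - 1‖ := by
  obtain ⟨k, rfl⟩ : ∃ k, n = k + 3 := ⟨n - 3, by omega⟩
  have : Fact (1 < k + 3) := ⟨by omega⟩
  have hpow' : z ^ (k + 2) = -1 := hpow
  have hlast : ‖1 + z ^ (k + 1)‖ = ‖z - 1‖ := by
    have : z * (1 + z ^ (k + 1)) = z - 1 := by linear_combination hpow'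
    rw [← this, norm_mul, hz, one_mul]
  refine ⟨fun j => if j.val = k + 2 then 1 + z ^ (k + 1) else z ^ j.val, fun j => ?_⟩
  have hj := ZMod.val_lt j
  have hnorm : ∀ i : ZMod (k + 3),
      1 ≤ ‖if i.val = k + 2 then 1 + z ^ (k + 1) else z ^ i.val‖ ∧
        ‖if i.val = k + 2 then 1 + z ^ (k + 1) else z ^ i.val‖ ≤ ‖z - 1‖ := by
    intro i
    split_ifs
    · exact ⟨hlast ▸ hz1, hlast.le⟩
    · simp [hz, hz1]
  refine ⟨(hnorm j).1, (hnorm j).2, ?_⟩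
  dsimp only
  by_cases hj0 : j = 0
  · subst hj0
    have h1 : (0 - 1 : ZMod (k + 3)).val = k + 2 := by
      rw [zero_sub]; exact ZMod.val_neg_one (k + 2)
    rw [h1, if_pos rfl, ZMod.val_zero, if_neg (by omega)]
    simp [hz, hz1]
  · have hpos : 0 < j.val := Nat.pos_of_ne_zero fun h => hj0 ((ZMod.val_eq_zero j).1 h)
    have h1 : (j - 1).val = j.val - 1 := by
      rw [ZMod.val_sub (by rw [ZMod.val_one]; exact hpos), ZMod.val_one]
    rw [h1, if_neg (show ¬ j.val - 1 = k + 2 by omega)]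
    split_ifs with h
    · rw [h, show k + 2 - 1 = k + 1 by omega]
      simp [hz1]
    · obtain ⟨i, hi⟩ : ∃ i, j.val = i + 1 := ⟨j.val - 1, by omega⟩
      rw [hi, Nat.add_sub_cancel, show z ^ (i + 1) - z ^ i = z ^ i * (z - 1) by ring,
        norm_mul, norm_pow, hz, one_pow, one_mul]
      exact ⟨hz1, le_rfl⟩

theorem wheel_mod_three_least (n : ℕ) (hn : 3 ≤ n) (hmod : n % 6 = 3) :
    IsLeast {l : ℝ | ∃ p : ZMod n → ℂ, ∀ j : ZMod n,
        1 ≤ ‖p j‖ ∧ ‖p j‖ ≤ l ∧ 1 ≤ ‖p j - p (j - 1)‖ ∧ ‖p j - p (j - 1)‖ ≤ l}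
      (2 * Real.sin (Real.pi / 6 * ((n : ℝ) / ((n : ℝ) - 1)))) := by
  have hpi := pi_pos
  have : NeZero n := ⟨by omega⟩
  have hn' : (3 : ℝ) ≤ n := by exact_mod_cast hn
  have hn1 : (0 : ℝ) < n - 1 := by linarith
  set T : ℝ := π / 6 * (n / (n - 1)) with hT
  have hTn : T * (n - 1) = π / 6 * n := by rw [hT]; field_simp
  have hT6 : π / 6 ≤ T := by
    by_contra! h
    nlinarith
  have hT4 : T ≤ π / 4 := by
    by_contra! h
    nlinarith
  have hsin6 : sin (π / 6) ≤ sin T :=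
    sin_le_sin_of_le_of_le_pi_div_two (by linarith) (by linarith) hT6
  rw [sin_pi_div_six] at hsin6
  constructor
  · have hnorm : ‖Complex.exp (Complex.I * (2 * T : ℝ)) - 1‖ = 2 * sin T := by
      rw [Complex.norm_exp_I_mul_ofReal_sub_one, mul_div_cancel_left₀ _ two_ne_zero,
        Real.norm_of_nonneg (by linarith)]
    have h := exists_admissible hn (z := Complex.exp (Complex.I * (2 * T : ℝ)))
      (by rw [mul_comm]; exact Complex.norm_exp_ofReal_mul_I _) (by rw [hnorm]; linarith) ?_
    · rwa [hnorm] at h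
    · obtain ⟨k, rfl⟩ : ∃ k, n = 6 * k + 3 := ⟨n / 6, by omega⟩
      have h2 : ((6 * k + 3 - 1 : ℕ) : ℝ) * (2 * T) = π + k * (2 * π) := by
        rw [Nat.cast_sub (by omega)]
        push_cast at hTn ⊢
        linear_combination 2 * hTn
      rw [← Complex.exp_nat_mul, show ((6 * k + 3 - 1 : ℕ) : ℂ) * (Complex.I * (2 * T : ℝ))
        = ((((6 * k + 3 - 1 : ℕ) : ℝ) * (2 * T) : ℝ) : ℂ) * Complex.I by push_cast; ring, h2]
      push_cast
      rw [add_mul, Complex.exp_add, Complex.exp_pi_mul_I, mul_assoc,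
        Complex.exp_nat_mul_two_pi_mul_I, mul_one]
  · rintro l ⟨p, hp⟩
    by_contra! hlt
    have hl1 : 1 ≤ l := (hp 0).1.trans (hp 0).2.1
    have hp0 : ∀ j, p j ≠ 0 := fun j => norm_pos_iff.1 (by linarith [(hp j).1])
    have harc6 : arcsin (1 / 2) = π / 6 := by
      rw [← sin_pi_div_six, arcsin_sin (by linarith) (by linarith)]
    set t := arcsin (l / 2) with ht
    have hsinT1 := sin_le_one T
    have hst : sin t = l / 2 := sin_arcsin (by linarith) (by linarith)
    have htT : t < T := by
      rw [ht, ← arcsin_sin (x := T) (by linarith) (by linarith)]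
      exact arcsin_lt_arcsin (by linarith) (by linarith) (by linarith)
    set x : ZMod n → ℝ := fun j => arcsin (‖p j‖ / 2) with hx
    have hsx : ∀ j, ‖p j‖ = 2 * sin (x j) := by
      intro j
      rw [hx, sin_arcsin (by linarith [(hp j).1]) (by linarith [(hp j).2.1])]
      ring
    have hx6 : ∀ j, π / 6 ≤ x j := fun j => by
      rw [← harc6]
      exact monotone_arcsin (by linarith [(hp j).1])
    have hxt : ∀ j, x j ≤ t := fun j => monotone_arcsin (by linarith [(hp j).2.1])
    set α : ZMod n → ℝ := fun j => Complex.arg (p j / p (j - 1)) with hα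
    have hdist : ∀ j, ‖p j - p (j - 1)‖ ^ 2 = (2 * sin (x j)) ^ 2 + (2 * sin (x (j - 1))) ^ 2
        - 2 * (2 * sin (x j)) * (2 * sin (x (j - 1))) * cos (α j) := fun j => by
      rw [← hsx, ← hsx]
      exact norm_sub_sq_eq_arg_div (hp0 j) (hp0 (j - 1))
    have hlow : ∀ j, 2 * π / 3 - x j - x (j - 1) ≤ |α j| := fun j =>
      le_abs_of_one_le_dist (hx6 _) (hx6 _) (by linarith [hxt j]) (by linarith [hxt (j - 1)]) (by
          rw [← hdist]
          exact one_le_pow₀ (hp j).2.2.1)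
    have hupp : ∀ j, |α j| ≤ 2 * t + π / 3 - x j - x (j - 1) := fun j =>
      abs_le_of_dist_le (hx6 _) (hx6 _) (hxt _) (hxt _) (by linarith)
        (Complex.abs_arg_le_pi _) (by
          rw [← hdist, hst, mul_div_cancel₀ _ two_ne_zero]
          exact pow_le_pow_left₀ (norm_nonneg _) (hp j).2.2.2 2)
    obtain ⟨m, hm⟩ := exists_sum_arg_div_eq hp0
    refine sum_steps_ne_two_pi_mul hn hmod (α := α) (g := fun j => x j - π / 6)
      (e := t - π / 6) ?_ ?_ ?_ ?_ ?_ ?_ m hm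
    · nlinarith
    · intro j
      refine abs_pos.1 (lt_of_lt_of_le ?_ (hlow j))
      linarith [hxt j, hxt (j - 1)]
    · intro j; linarith [hx6 j]
    · intro j; linarith [hxt j]
    · intro j; linarith [hlow j]
    · intro j; linarith [hupp j]
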